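/- (Order-matrix content of reduction from Ritt's second form.) Let n ≥ 2 and let A = (a_{i,j}) and B = (b_{i,j}) be n×n matrices with entries in ℤ ∪ {−∞}. Assume: (i) tdet(A) = a_{1,n} + (∑_{i=2}^{n−1} a_{i,i}) + a_{n,1}; (ii) tdet(Ã_{n,n}) = ∑_{i=1}^{n−1} a_{i,i} and a_{i,i} ≠ −∞ for 1 ≤ i ≤ n−1, where Ã_{n,n} is the submatrix of A obtained by deleting the last row and last column; (iii) a_{n,1} = max{a_{1,1}, a_{2,1}, …, a_{n,1}}; (iv) b_{i,j} = a_{i,j} for all j whenever i ≠ n; (v) for every j, b_{n,j} + a_{1,1} ≤ max(a_{n,j} + a_{1,1}, a_{1,j} + a_{n,1}) (since a_{1,1} is finite, this says b_{n,j} ≤ max(a_{n,j}, a_{1,j} + a_{n,1} − a_{1,1}), the inequality satisfied by the order matrix after Ritt ∂-division of u_n by u₁ in the first variable). Then tdet(B) ≤ tdet(A). -/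

import Mathlib

/-- The tropical determinant of a square matrix with entries in `ℤ ∪ {−∞}`:
the maximum over all permutations `ρ` of the transversal `∑ i, A i (ρ i)`. -/
noncomputable def tdet {ι : Type*} [Fintype ι] [DecidableEq ι]
    (A : Matrix ι ι (WithBot ℤ)) : WithBot ℤ :=
  Finset.univ.sup fun ρ : Equiv.Perm ι => ∑ i, A i (ρ i)

theorem sum_le_tdet {ι : Type*} [Fintype ι] [DecidableEq ι] (A : Matrix ι ι (WithBot ℤ))
    (g : ι → ι) (hg : Function.Injective g) : ∑ c, A (g c) c ≤ tdet A := by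
  let e : Equiv.Perm ι := Equiv.ofBijective g (Finite.injective_iff_bijective.mp hg)
  calc ∑ c, A (g c) c = ∑ c, A (e c) (e.symm (e c)) := by simp [e]
    _ = ∑ i, A i (e.symm i) := Equiv.sum_comp e fun i => A i (e.symm i)
    _ ≤ tdet A := Finset.le_sup (f := fun ρ : Equiv.Perm ι => ∑ i, A i (ρ i))
        (Finset.mem_univ e.symm)

/-- If `σ` misses `q` and is injective away from the fibre over `p`, then the points on the
`σ`-path from `q` to `p`, with `p` excluded, form a set whose complement is `σ`-stable. -/
theorem exists_path_finset {ι : Type*} [Fintype ι] [DecidableEq ι] {p q : ι} (hpq : p ≠ q)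
    (σ : ι → ι) (hq : ∀ c, σ c ≠ q) (hσ : ∀ c d, σ c = σ d → σ c ≠ p → c = d) :
    ∃ S : Finset ι, q ∈ S ∧ p ∉ S ∧ (∀ c ∈ S, σ c ∈ insert p S) ∧ Set.InjOn σ S ∧
      (∃ s ∈ S, σ s = p) ∧ ∀ c ∉ S, σ c ∉ S := by
  let P : Finset ι → Prop := fun S => q ∈ S ∧ p ∉ S ∧ ∀ c ∈ S, σ c ∈ insert p S
  have hP : P (Finset.univ.erase p) := by
    refine ⟨by simp [hpq.symm], by simp, fun c _ => ?_⟩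
    by_cases h : σ c = p <;> simp [h]
  obtain ⟨S, -, hS⟩ := (Set.toFinite {S | P S}).exists_le_minimal hP
  obtain ⟨⟨hqS, hpS, hmaps⟩, hmin⟩ := hS
  have hsurj : ∀ c ∈ S, c ≠ q → ∃ s ∈ S, σ s = c := by
    intro c hc hcq
    by_contra! hne
    have hle : S ≤ S.erase c := by
      refine hmin ⟨by simp [hqS, hcq.symm], by simp [hpS], fun d hd => ?_⟩
        (Finset.erase_subset c S)
      have hdS := Finset.mem_of_mem_erase hd
      have h1 := hmaps d hdS
      have h2 := hne d hdS
      simp only [Finset.mem_insert, Finset.mem_erase] at h1 ⊢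
      tauto
    exact Finset.notMem_erase c S (hle hc)
  have hend : ∃ s ∈ S, σ s = p := by
    by_contra! hne
    have hsub : S.image σ ⊆ S.erase q := by
      intro x hx
      obtain ⟨c, hc, rfl⟩ := Finset.mem_image.mp hx
      have h1 := hmaps c hc
      have h2 := hne c hc
      simp only [Finset.mem_insert, Finset.mem_erase] at h1 ⊢
      exact ⟨hq c, by tauto⟩
    have hcard : (S.image σ).card = S.card :=
      Finset.card_image_of_injOn fun c hc d _ h => hσ c d h (hne c hc)
    have := Finset.card_le_card hsub
    have := Finset.card_erase_lt_of_mem hqS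
    omega
  refine ⟨S, hqS, hpS, hmaps, ?_, hend, ?_⟩
  · have hsub : insert p (S.erase q) ⊆ S.image σ := by
      intro x hx
      rw [Finset.mem_image]
      rcases Finset.mem_insert.mp hx with rfl | hx
      · exact hend
      · exact hsurj x (Finset.mem_of_mem_erase hx) (Finset.ne_of_mem_erase hx)
    have h1 := Finset.card_le_card hsub
    rw [Finset.card_insert_of_notMem (by simp [hpS]),
      Finset.card_erase_add_one hqS] at h1
    exact Finset.card_image_iff.mp (le_antisymm Finset.card_image_le h1)
  · intro c hc hcS
    obtain ⟨s, hs, h⟩ := hsurj _ hcS (hq c)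
    have : s = c := hσ s c h (by rw [h]; rintro h'; exact hpS (h' ▸ hcS))
    exact hc (this ▸ hs)

/-- A choice `σ` of one row per column which misses row `q`, doubles row `p` and uses every other
row at most once exchanges with the diagonal to give a permutation `g` of all indices and a
permutation `h` fixing `q`. -/
theorem exists_injective_exchange {ι : Type*} [Fintype ι] [DecidableEq ι] {p q : ι} (hpq : p ≠ q)
    (σ : ι → ι) (hq : ∀ c, σ c ≠ q) (hσ : ∀ c d, σ c = σ d → σ c ≠ p → c = d)
    (j k : ι) (hp : ∀ c, σ c = p → c = j ∨ c = k) :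
    ∃ g h : ι → ι, Function.Injective g ∧ Function.Injective h ∧ h q = q ∧ g q = σ q ∧
      g p = q ∧ h p = σ p ∧
      ∀ c, c ≠ p → c ≠ q → (g c = σ c ∧ h c = c) ∨ (g c = c ∧ h c = σ c) := by
  obtain ⟨S, hqS, hpS, hmaps, hinj, ⟨s, hsS, hs⟩, hcompl⟩ := exists_path_finset hpq σ hq hσ
  simp only [Finset.mem_insert] at hmaps
  refine ⟨fun c => if c ∈ S then σ c else if c = p then q else c,
    fun c => if c ∈ S then c else σ c, ?_, ?_, by simp [hqS], by simp [hqS], by simp [hpS],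
    by simp [hpS], ?_⟩
  · intro c d hcd
    have := @hinj c
    grind
  · intro c d hcd
    have hcd' : c ∉ S → d ∉ S → σ c = σ d → c = d := by
      intro hc hd h
      by_cases hcp : σ c = p
      · have h1 := hp c hcp
        have h2 := hp d (h ▸ hcp)
        have h3 := hp s hs
        grind
      · exact hσ c d h hcp
    grind
  · intro c hc _
    by_cases h : c ∈ S <;> simp [h, hc]

theorem sum_castSucc_le_tdet {n : ℕ} (A : Matrix (Fin (n + 1)) (Fin (n + 1)) (WithBot ℤ))
    (h : Fin (n + 1) → Fin (n + 1)) (hinj : Function.Injective h)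
    (hlast : h (Fin.last n) = Fin.last n) :
    ∑ c : Fin n, A (h c.castSucc) c.castSucc ≤
      tdet (Matrix.of fun i j : Fin n => A i.castSucc j.castSucc) := by
  have hne (c : Fin n) : h c.castSucc ≠ Fin.last n := fun hc =>
    c.castSucc_ne_last (hinj (hc.trans hlast.symm))
  refine le_of_eq_of_le ?_ (sum_le_tdet _ (fun c => (h c.castSucc).castPred (hne c)) ?_)
  · simp
  · intro c d hcd
    exact Fin.castSucc_injective n (hinj (Fin.castPred_inj.mp hcd))

/-- **Order-matrix content of the reduction from Ritt's second form.**
Indices are `0`-based: row/column `0` plays the role of `1`, and `Fin.last (n+1)`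
plays the role of `n`; the matrices have size `n + 2 ≥ 2`.
Hypotheses (i)–(iii) say `A` is in Ritt's second form:
(i) `tdet A = a_{1,n} + (∑_{i=2}^{n-1} a_{i,i}) + a_{n,1}`;
(ii) the tropical determinant of the submatrix `Ã_{n,n}` (delete last row and column)
is `∑_{i=1}^{n-1} a_{i,i}` with these diagonal entries finite;
(iii) `a_{n,1}` is the maximum of the first column.
Moreover `B` agrees with `A` except in the last row, whose entries satisfy the
Ritt-division inequality `b_{n,j} ≤ max (a_{n,j}, a_{1,j} + a_{n,1} − a_{1,1})`
(written additively).  Then `tdet B ≤ tdet A`. -/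
theorem ritt_second_reduction (n : ℕ)
    (A B : Matrix (Fin (n + 2)) (Fin (n + 2)) (WithBot ℤ))
    (hA : tdet A = A 0 (Fin.last (n + 1)) +
        (∑ i ∈ (Finset.univ.erase (0 : Fin (n + 2))).erase (Fin.last (n + 1)), A i i) +
        A (Fin.last (n + 1)) 0)
    (hsub : tdet (Matrix.of fun i j : Fin (n + 1) => A i.castSucc j.castSucc) =
        ∑ i : Fin (n + 1), A i.castSucc i.castSucc)
    (hdiag : ∀ i : Fin (n + 1), A i.castSucc i.castSucc ≠ ⊥)
    (hmax : ∀ i, A i 0 ≤ A (Fin.last (n + 1)) 0)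
    (hB : ∀ i, i ≠ Fin.last (n + 1) → ∀ j, B i j = A i j)
    (hdiv : ∀ j, B (Fin.last (n + 1)) j + A 0 0 ≤
        max (A (Fin.last (n + 1)) j + A 0 0) (A 0 j + A (Fin.last (n + 1)) 0)) :
    tdet B ≤ tdet A := by
  refine Finset.sup_le fun ρ _ => ?_
  set q := Fin.last (n + 1) with hqdef
  have hpq : (0 : Fin (n + 2)) ≠ q := Fin.last_pos.ne
  have hrow : ∑ i ∈ Finset.univ.erase q, B i (ρ i) = ∑ i ∈ Finset.univ.erase q, A i (ρ i) :=
    Finset.sum_congr rfl fun i hi => hB i (Finset.ne_of_mem_erase hi) _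
  rw [← Finset.add_sum_erase _ _ (Finset.mem_univ q), hrow]
  set R := ∑ i ∈ Finset.univ.erase q, A i (ρ i) with hR
  have h00 : A 0 0 ≠ ⊥ := hdiag 0
  rcases le_max_iff.mp (hdiv (ρ q)) with hle | hle
  · have hle' : B q (ρ q) ≤ A q (ρ q) := (WithBot.add_le_add_iff_right h00).mp hle
    calc B q (ρ q) + R ≤ A q (ρ q) + R := by gcongr
      _ = ∑ i, A i (ρ i) := Finset.add_sum_erase _ (fun i => A i (ρ i)) (Finset.mem_univ q)
      _ ≤ tdet A := Finset.le_sup (f := fun ρ : Equiv.Perm _ => ∑ i, A i (ρ i))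
        (Finset.mem_univ ρ)
  let σ : Fin (n + 2) → Fin (n + 2) := fun c => if c = ρ q then 0 else ρ.symm c
  have hσR : ∑ c, A (σ c) c = A 0 (ρ q) + R := by
    rw [← Equiv.sum_comp ρ, ← Finset.add_sum_erase _ _ (Finset.mem_univ q), hR]
    congr 1
    · simp [σ]
    · refine Finset.sum_congr rfl fun i hi => ?_
      simp [σ, Finset.ne_of_mem_erase hi]
  obtain ⟨g, h, hg, hh, hhq, hgq, hg0, hh0, hgh⟩ :=
    exists_injective_exchange hpq σ
      (fun c => by
        by_cases hc : c = ρ q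
        · simp [σ, hc, hpq]
        · simp [σ, hc, Equiv.symm_apply_eq])
      (fun c d hcd hc => by
        have := fun h => ρ.symm.injective (a₁ := c) (a₂ := d) h
        grind)
      (ρ q) (ρ 0) (fun c hc => by
        by_cases h : c = ρ q
        · exact Or.inl h
        · exact Or.inr (by simpa [σ, h, Equiv.symm_apply_eq] using hc))
  set I := (Finset.univ.erase (0 : Fin (n + 2))).erase q with hI
  have hsplit (f : Fin (n + 2) → WithBot ℤ) : ∑ c, f c = f 0 + (f q + ∑ c ∈ I, f c) := by
    rw [Finset.add_sum_erase _ _ (by simp [hpq.symm]), Finset.add_sum_erase _ _ (by simp)]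
  have hsplit' (f : Fin (n + 2) → WithBot ℤ) :
      ∑ c : Fin (n + 1), f c.castSucc = f 0 + ∑ c ∈ I, f c := by
    have hcast : Finset.univ.erase q = Finset.univ.map (Fin.castSuccEmb (n := n + 1)) := by
      ext c
      induction c using Fin.lastCases <;> simp [hqdef]
    rw [hI, Finset.erase_right_comm, Finset.add_sum_erase _ _ (by simp [hpq]), hcast,
      Finset.sum_map]
    rfl
  have hdiagI : ∑ c ∈ I, A c c + A 0 0 ≠ ⊥ := by
    rw [add_comm, ← hsplit' fun c => A c c]
    simpa [WithBot.sum_eq_bot_iff] using hdiag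
  have hgle := sum_le_tdet A g hg
  have hhle := sum_castSucc_le_tdet A h hh hhq
  rw [hsub, hsplit' fun c => A c c, hsplit' fun c => A (h c) c, hh0] at hhle
  rw [hsplit, hg0, hgq] at hgle
  have hsum : ∑ c ∈ I, A (g c) c + ∑ c ∈ I, A (h c) c =
      ∑ c ∈ I, A (σ c) c + ∑ c ∈ I, A c c := by
    rw [← Finset.sum_add_distrib, ← Finset.sum_add_distrib]
    refine Finset.sum_congr rfl fun c hc => ?_
    simp only [hI, Finset.mem_erase, Finset.mem_univ, and_true] at hc
    rcases hgh c hc.2 hc.1 with ⟨h1, h2⟩ | ⟨h1, h2⟩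
    · rw [h1, h2]
    · rw [h1, h2, add_comm]
  refine (WithBot.add_le_add_iff_right hdiagI).mp ?_
  calc B q (ρ q) + R + (∑ c ∈ I, A c c + A 0 0)
      = (B q (ρ q) + A 0 0) + (R + ∑ c ∈ I, A c c) := by abel
    _ ≤ (A 0 (ρ q) + A q 0) + (R + ∑ c ∈ I, A c c) := by gcongr
    _ = A q 0 + (A 0 (ρ q) + R) + ∑ c ∈ I, A c c := by abel
    _ = A q 0 + A (σ 0) 0 + A (σ q) q + (∑ c ∈ I, A (σ c) c + ∑ c ∈ I, A c c) := by
        rw [← hσR, hsplit]; abel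
    _ = (A q 0 + (A (σ q) q + ∑ c ∈ I, A (g c) c)) + (A (σ 0) 0 + ∑ c ∈ I, A (h c) c) := by
        rw [← hsum]; abel
    _ ≤ tdet A + (A 0 0 + ∑ c ∈ I, A c c) := add_le_add hgle hhle
    _ = tdet A + (∑ c ∈ I, A c c + A 0 0) := by rw [add_comm (A 0 0)]
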